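/- There is an absolute constant C > 0 such that for every integer h ≥ 1 and every polygonal domain P = P₀ \ ⋃_{i=1}^h interior(Pᵢ) in 𝒞(h) in which every hole satisfies diam₂(Pᵢ) ≤ h^{-1/3}·diam₂(P), the geodesic diameter satisfies diam_g(P) ≤ C·h^{1/3}·diam₂(P). -/

import Mathlib

open Set Metric ENNReal RealInnerProductSpace

noncomputable section

/-- The Euclidean plane. -/
abbrev Plane := EuclideanSpace ℝ (Fin 2)

/-- A convex polygon: the convex hull of a nonempty finite point set. -/
def IsConvexPolygon (Q : Set Plane) : Prop :=
  ∃ S : Finset Plane, S.Nonempty ∧ Q = convexHull ℝ (S : Set Plane)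

/-- `γ` is a continuous path from `s` to `t` (parametrized on `[0,1]`) with image in `P`. -/
def IsPathIn (P : Set Plane) (γ : ℝ → Plane) (s t : Plane) : Prop :=
  ContinuousOn γ (Set.Icc 0 1) ∧ γ 0 = s ∧ γ 1 = t ∧ Set.MapsTo γ (Set.Icc 0 1) P

/-- Length of a path: its total variation on `[0,1]`. -/
def pathLen (γ : ℝ → Plane) : ℝ≥0∞ := eVariationOn γ (Set.Icc 0 1)

/-- Geodesic distance inside `P`: infimum of lengths of continuous paths
from `s` to `t` contained in `P`. -/
def geod (P : Set Plane) (s t : Plane) : ℝ≥0∞ :=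
  ⨅ γ : {γ : ℝ → Plane // IsPathIn P γ s t}, pathLen γ.1

/-- Geodesic diameter of `P`. -/
def geodDiam (P : Set Plane) : ℝ≥0∞ :=
  ⨆ s ∈ P, ⨆ t ∈ P, geod P s t

/-- The width of a planar set: the minimum, over unit directions `v`,
of the extent of `C` in direction `v`. -/
def setWidth (C : Set Plane) : ℝ :=
  ⨅ v : {v : Plane // ‖v‖ = 1},
    (sSup ((fun x => ⟪x, v.1⟫) '' C) - sInf ((fun x => ⟪x, v.1⟫) '' C))

/-- `s` and `t` are joined by a path inside `P` with a `1`-Lipschitz parametrization on `[0, L]`. -/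
def Reach (P : Set Plane) (s t : Plane) (L : ℝ) : Prop :=
  0 ≤ L ∧ ∃ γ : ℝ → Plane, LipschitzWith 1 γ ∧ γ 0 = s ∧ γ L = t ∧ ∀ u ∈ Set.Icc 0 L, γ u ∈ P

theorem Reach.mono {P P' : Set Plane} {s t : Plane} {L : ℝ} (h : Reach P s t L) (hP : P ⊆ P') :
    Reach P' s t L := by
  obtain ⟨hL, γ, h1, h2, h3, h4⟩ := h
  exact ⟨hL, γ, h1, h2, h3, fun u hu => hP (h4 u hu)⟩

theorem Reach.symm {P : Set Plane} {s t : Plane} {L : ℝ} (h : Reach P s t L) :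
    Reach P t s L := by
  obtain ⟨hL, γ, h1, h2, h3, h4⟩ := h
  refine ⟨hL, fun u => γ (L - u), ?_, by simpa using h3, by simpa using h2, fun u hu => h4 _ ?_⟩
  · refine LipschitzWith.of_dist_le_mul fun x y => (h1.dist_le_mul _ _).trans ?_
    rw [dist_sub_left, NNReal.coe_one, one_mul]
  · exact ⟨by linarith [hu.2], by linarith [hu.1]⟩

theorem Reach.le {P : Set Plane} {s t : Plane} {L L' : ℝ} (h : Reach P s t L) (hL' : L ≤ L') :
    Reach P s t L' := by
  obtain ⟨hL, γ, h1, h2, h3, h4⟩ := h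
  refine ⟨hL.trans hL', fun u => γ (min u L), ?_, by simpa [hL] using h2,
    by simpa [hL'] using h3, fun u hu => h4 _ ⟨le_min hu.1 hL, min_le_right _ _⟩⟩
  have := h1.comp (LipschitzWith.id.min_const L)
  rwa [one_mul] at this

theorem Reach.trans {P : Set Plane} {s t r : Plane} {L L' : ℝ} (h : Reach P s t L)
    (h' : Reach P t r L') : Reach P s r (L + L') := by
  obtain ⟨hL, γ, h1, h2, h3, h4⟩ := h
  obtain ⟨hL', γ', h1', h2', h3', h4'⟩ := h'
  refine ⟨add_nonneg hL hL', fun u => γ (min u L) + (γ' (max (u - L) 0) - t), ?_, ?_, ?_, ?_⟩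
  · refine LipschitzWith.of_dist_le_mul fun x y => ?_
    have a := h1.dist_le_mul (min x L) (min y L)
    have b := h1'.dist_le_mul (max (x - L) 0) (max (y - L) 0)
    refine (dist_add_add_le _ _ _ _).trans ?_
    rw [dist_sub_right]
    refine (add_le_add a b).trans ?_
    simp only [NNReal.coe_one, one_mul, Real.dist_eq]
    wlog hxy : x ≤ y generalizing x y
    · have := this y x (h1.dist_le_mul _ _) (h1'.dist_le_mul _ _) (le_of_not_ge hxy)
      simpa only [abs_sub_comm] using this
    rw [abs_sub_comm, abs_sub_comm (max _ _), abs_sub_comm x y,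
      abs_of_nonneg (sub_nonneg.2 (min_le_min_right L hxy)),
      abs_of_nonneg (sub_nonneg.2 (max_le_max_right 0 (sub_le_sub_right hxy L))),
      abs_of_nonneg (sub_nonneg.2 hxy)]
    grind
  · simp [hL, h2, h2']
  · simp [hL', h3, h3']
  · intro u hu
    rcases le_total u L with h | h
    · simpa [h, h2'] using h4 u ⟨hu.1, h⟩
    · simpa [h, h3] using h4' (u - L) ⟨by linarith, by linarith [hu.2]⟩

theorem Reach.of_segment {P : Set Plane} {s t : Plane} (h : segment ℝ s t ⊆ P) :
    Reach P s t (dist s t) := by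
  refine ⟨dist_nonneg, fun u => AffineMap.lineMap s t (u / dist s t), ?_, by simp, ?_, ?_⟩
  · refine LipschitzWith.of_dist_le_mul fun x y => ?_
    rw [dist_lineMap_lineMap, Real.dist_eq, ← sub_div, abs_div, abs_of_nonneg dist_nonneg,
      NNReal.coe_one, one_mul, Real.dist_eq]
    rcases eq_or_ne (dist s t) 0 with h0 | h0
    · simp [h0]
    · rw [div_mul_cancel₀ _ h0]
  · rcases eq_or_ne s t with rfl | hst
    · simp
    · simp [div_self (dist_ne_zero.2 hst)]
  · intro u hu
    refine h ?_
    rw [segment_eq_image_lineMap]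
    exact ⟨_, ⟨div_nonneg hu.1 dist_nonneg, div_le_one_of_le₀ hu.2 dist_nonneg⟩, rfl⟩

theorem Reach.geod_le {P : Set Plane} {s t : Plane} {L : ℝ} (h : Reach P s t L) :
    geod P s t ≤ ENNReal.ofReal L := by
  obtain ⟨hL, γ, h1, h2, h3, h4⟩ := h
  have hm : ∀ u ∈ Set.Icc (0 : ℝ) 1, L * u ∈ Set.Icc 0 L := fun u hu =>
    ⟨mul_nonneg hL hu.1, mul_le_of_le_one_right hL hu.2⟩
  have hp : IsPathIn P (γ ∘ fun u => L * u) s t :=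
    ⟨(h1.continuous.comp (continuous_const.mul continuous_id)).continuousOn, by simpa using h2,
      by simpa using h3, fun u hu => h4 _ (hm u hu)⟩
  refine (iInf_le _ ⟨_, hp⟩).trans ?_
  refine ((h1.lipschitzOnWith (s := Set.univ)).comp_eVariationOn_le
    (g := fun u => L * u) (Set.mapsTo_univ _ _)).trans ?_
  have hmono : MonotoneOn (fun u : ℝ => L * u) (Set.Icc 0 1) := fun x _ y _ hxy =>
    mul_le_mul_of_nonneg_left hxy hL
  have := hmono.eVariationOn_eq (Set.left_mem_Icc.2 zero_le_one) (Set.right_mem_Icc.2 zero_le_one)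
  simpa using this.le

theorem exists_pos_add_smul_mem {Q : Set Plane} {z : Plane} (hz : z ∈ interior Q) (d : Plane) :
    ∃ t : ℝ, 0 < t ∧ z + t • d ∈ Q := by
  have hc : Filter.Tendsto (fun t : ℝ => z + t • d) (nhdsWithin 0 (Set.Ioi 0)) (nhds z) := by
    have : Continuous fun t : ℝ => z + t • d := by fun_prop
    simpa using (this.tendsto 0).mono_left nhdsWithin_le_nhds
  have := (hc.eventually (mem_interior_iff_mem_nhds.1 hz)).and self_mem_nhdsWithin
  obtain ⟨t, ht, ht0⟩ := this.exists
  exact ⟨t, ht0, ht⟩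

/-- A path avoiding the interior of a closed convex set can be pushed onto its boundary
by the nearest point projection. -/
theorem Reach.project {Q : Set Plane} (hQ : Convex ℝ Q) (hc : IsClosed Q) {s t : Plane}
    (hs : s ∈ Q) (ht : t ∈ Q) {L : ℝ} (h : Reach (interior Q)ᶜ s t L) :
    Reach (Q \ interior Q) s t L := by
  have hex : ∀ u : Plane, ∃ v ∈ Q, ∀ w ∈ Q, ⟪u - v, w - v⟫ ≤ 0 := fun u => by
    obtain ⟨v, hv, h⟩ := exists_norm_eq_iInf_of_complete_convex ⟨s, hs⟩ hc.isComplete hQ u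
    exact ⟨v, hv, (norm_eq_iInf_iff_real_inner_le_zero hQ hv).1 h⟩
  choose π hπ hin using hex
  have hfix : ∀ u ∈ Q, π u = u := fun u hu => by
    have := hin u u hu
    rw [real_inner_self_eq_norm_sq] at this
    have h0 : ‖u - π u‖ = 0 := by nlinarith [norm_nonneg (u - π u)]
    exact (sub_eq_zero.1 (norm_eq_zero.1 h0)).symm
  have hfr : ∀ u ∉ interior Q, π u ∉ interior Q := fun u hu hm => by
    obtain ⟨t, ht, hmem⟩ := exists_pos_add_smul_mem hm (u - π u)
    have := hin u _ hmem
    rw [add_sub_cancel_left, inner_smul_right, real_inner_self_eq_norm_sq] at this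
    have h0 : ‖u - π u‖ = 0 := by
      by_contra hne
      have : 0 < ‖u - π u‖ := lt_of_le_of_ne (norm_nonneg _) (Ne.symm hne)
      nlinarith [mul_pos ht (pow_pos this 2)]
    exact hu ((sub_eq_zero.1 (norm_eq_zero.1 h0)) ▸ hm)
  have hlip : LipschitzWith 1 π := by
    refine LipschitzWith.of_dist_le_mul fun x y => ?_
    rw [NNReal.coe_one, one_mul, dist_eq_norm, dist_eq_norm]
    have h1 := hin x _ (hπ y)
    have h2 := hin y _ (hπ x)
    have h3 : ‖π x - π y‖ ^ 2 ≤ ⟪x - y, π x - π y⟫ := by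
      rw [← real_inner_self_eq_norm_sq]
      have e : x - y = (x - π x) - (y - π y) + (π x - π y) := by abel
      have e' : π y - π x = -(π x - π y) := by abel
      rw [e', inner_neg_right] at h1
      rw [e, inner_add_left, inner_sub_left (x - π x)]
      linarith
    have h4 := real_inner_le_norm (x - y) (π x - π y)
    by_contra! hlt
    nlinarith [norm_nonneg (x - y), norm_nonneg (π x - π y)]
  obtain ⟨hL, γ, h1, h2, h3, h4⟩ := h
  refine ⟨hL, π ∘ γ, by simpa using hlip.comp h1, ?_, ?_, fun u hu => ⟨hπ _, hfr _ (h4 u hu)⟩⟩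
  · rw [Function.comp_apply, h2, hfix s hs]
  · rw [Function.comp_apply, h3, hfix t ht]

/-- The linear functional `z ↦ z₀ + c z₁`. -/
def lin (c : ℝ) (z : Plane) : ℝ := z 0 + c * z 1

theorem continuous_lin (c : ℝ) : Continuous (lin c) := by
  unfold lin; fun_prop

theorem abs_coord_sub_le_dist (s t : Plane) (i : Fin 2) : |s i - t i| ≤ dist s t := by
  rw [dist_eq_norm]
  exact PiLp.norm_apply_le (s - t) i

theorem dist_le_abs_add_abs (s t : Plane) : dist s t ≤ |s 0 - t 0| + |s 1 - t 1| := by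
  rw [EuclideanSpace.dist_eq, Fin.sum_univ_two, Real.dist_eq, Real.dist_eq]
  refine Real.sqrt_le_iff.2 ⟨by positivity, ?_⟩
  nlinarith [abs_nonneg (s 0 - t 0), abs_nonneg (s 1 - t 1)]

/-- A nonzero linear functional does not attain its maximum at an interior point. -/
theorem lt_of_mem_interior {Q : Set Plane} {a b M : ℝ} (hab : a ≠ 0 ∨ b ≠ 0)
    (h : ∀ z ∈ Q, a * z 0 + b * z 1 ≤ M) {z : Plane} (hz : z ∈ interior Q) :
    a * z 0 + b * z 1 < M := by
  obtain ⟨t, ht, hm⟩ := exists_pos_add_smul_mem hz !₂[a, b]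
  have h1 := h _ hm
  have h2 : 0 < a * a + b * b := by
    rcases hab with h | h
    · nlinarith [mul_self_pos.2 h, mul_self_nonneg b]
    · nlinarith [mul_self_pos.2 h, mul_self_nonneg a]
  simp at h1
  nlinarith [mul_pos ht h2]

theorem exists_support {Q : Set Plane} (hQ : Convex ℝ Q) (hne : (interior Q).Nonempty)
    {q : Plane} (hq : q ∉ interior Q) (c : ℝ) :
    ∃ a b : ℝ, (a ≠ 0 ∨ b ≠ 0) ∧ ∀ z ∈ Q, a * lin c z + b * z 1 ≤ a * lin c q + b * q 1 := by
  obtain ⟨f, u, hf, h1, h2⟩ := geometric_hahn_banach_of_nonempty_interior hQ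
    (convex_singleton q) (Set.disjoint_singleton_right.2 hq) hne (Set.singleton_nonempty q)
  have hz : ∀ z : Plane, f z = z 0 * f (EuclideanSpace.single 0 1) +
      z 1 * f (EuclideanSpace.single 1 1) := fun z => by
    have : z = z 0 • EuclideanSpace.single (0 : Fin 2) (1 : ℝ) +
        z 1 • EuclideanSpace.single (1 : Fin 2) (1 : ℝ) := by
      ext i; fin_cases i <;> simp
    conv_lhs => rw [this]
    simp
  refine ⟨f (EuclideanSpace.single 0 1),
    f (EuclideanSpace.single 1 1) - c * f (EuclideanSpace.single 0 1), ?_, fun z hzQ => ?_⟩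
  · by_contra! h
    refine hf (ContinuousLinearMap.ext fun z => ?_)
    rw [hz z, h.1]
    have : f (EuclideanSpace.single 1 1) = 0 := by simpa [h.1] using h.2
    simp [this]
  · have := (h1 z hzQ).trans (h2 q rfl)
    rw [hz z, hz q] at this
    unfold lin
    linarith

theorem mem_segment_eq {A B z : Plane} (h : z ∈ segment ℝ A B) :
    ∃ t : ℝ, 0 ≤ t ∧ t ≤ 1 ∧ ∀ i, z i = A i + t * (B i - A i) := by
  rw [segment_eq_image_lineMap] at h
  obtain ⟨t, ht, rfl⟩ := h
  refine ⟨t, ht.1, ht.2, fun i => ?_⟩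
  simp [AffineMap.lineMap_apply]
  ring

/-- Walking around a convex set on its left, top (or bottom, for `σ = -1`) and right sides, in the
coordinates `(lin c, z₁)`. -/
theorem reach_box {Q : Set Plane} (hQ : Convex ℝ Q) (hcl : IsClosed Q) {c : ℝ} (hc : 0 ≤ c)
    (hc1 : c ≤ 1) {σ : ℝ} (hσ : σ = 1 ∨ σ = -1) {q e : Plane} (hqQ : q ∈ Q) (heQ : e ∈ Q)
    (he : ∀ z ∈ Q, lin c z ≤ lin c e) {a b : ℝ} (hab : a ≠ 0 ∨ b ≠ 0) (hb : 0 ≤ b)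
    (hs : ∀ z ∈ Q, a * lin c z + b * (σ * z 1) ≤ a * lin c q + b * (σ * q 1))
    {H : ℝ} (hH0 : 0 ≤ H) (hH : ∀ z ∈ Q, lin c q ≤ lin c z → σ * z 1 ≤ σ * q 1 + H) :
    Reach (Q \ interior Q) q e
      (2 * H + (lin c e - lin c q) + 2 * (σ * q 1 + H - σ * e 1)) := by
  have hσσ : σ * σ = 1 := by rcases hσ with rfl | rfl <;> norm_num
  have hσa : |σ| = 1 := by rcases hσ with rfl | rfl <;> norm_num
  have hqe := he q hqQ
  have heH := hH e heQ hqe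
  refine Reach.project hQ hcl hqQ heQ ?_
  set A : Plane := !₂[q 0 - c * (σ * H), q 1 + σ * H] with hA
  set D := lin c e - lin c q with hD
  set B : Plane := !₂[A 0 + D, A 1] with hB
  have hA0 : A 0 = q 0 - c * (σ * H) := by simp [hA]
  have hA1 : A 1 = q 1 + σ * H := by simp [hA]
  have hB0 : B 0 = A 0 + D := by simp [hB]
  have hB1 : B 1 = A 1 := by simp [hB]
  have hσA : σ * A 1 = σ * q 1 + H := by rw [hA1]; linear_combination H * hσσ
  have hBX : lin c B = lin c e := by
    unfold lin; rw [hB0, hB1, hA0, hA1, hD]; unfold lin; ring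
  have hσ0 : σ ≠ 0 := by rintro rfl; simp at hσσ
  have r1 : Reach (interior Q)ᶜ q A (2 * H) := by
    refine (Reach.of_segment ?_).le ?_
    · intro z hz hzQ
      obtain ⟨t, ht0, ht1, hz⟩ := mem_segment_eq hz
      have h1 : (a : ℝ) ≠ 0 ∨ a * c + b * σ ≠ 0 := by
        by_contra! h
        rcases hab with h' | h'
        · exact h' h.1
        · rw [h.1, zero_mul, zero_add] at h
          exact mul_ne_zero h' hσ0 h.2
      have := lt_of_mem_interior h1 (M := a * lin c q + b * (σ * q 1)) (fun z hz => by
        have := hs z hz; unfold lin at this ⊢; linarith) hzQ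
      rw [hz 0, hz 1, hA0, hA1] at this
      unfold lin at this
      have h2 : 0 ≤ b * (t * H) := by positivity
      have h3 : b * (t * H) = b * (t * (σ * σ * H)) := by rw [hσσ, one_mul]
      linarith
    · refine (dist_le_abs_add_abs _ _).trans ?_
      rw [hA0, hA1, sub_sub_self, sub_add_cancel_left, abs_neg, abs_mul, abs_mul, hσa,
        abs_of_nonneg hc, abs_of_nonneg hH0]
      nlinarith
  have r2 : Reach (interior Q)ᶜ A B D := by
    refine (Reach.of_segment ?_).le ?_
    · intro z hz hzQ
      obtain ⟨t, ht0, ht1, hz⟩ := mem_segment_eq hz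
      obtain ⟨r, hr, hm⟩ := exists_pos_add_smul_mem hzQ !₂[-c * σ, σ]
      have hX : lin c q ≤ lin c (z + r • !₂[-c * σ, σ]) := by
        simp [lin, hz, hB0, hB1, hA0, hA1]
        have : 0 ≤ t * D := mul_nonneg ht0 (sub_nonneg.2 hqe)
        linarith
      have := hH _ hm hX
      simp [hz, hB1] at this
      have e2 : σ * (A 1 + r * σ) = σ * A 1 + r := by linear_combination r * hσσ
      linarith
    · refine (dist_le_abs_add_abs _ _).trans ?_
      rw [hB0, hB1, sub_add_cancel_left, abs_neg, abs_of_nonneg (sub_nonneg.2 hqe)]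
      simp [hD]
  have r3 : Reach (interior Q)ᶜ B e (2 * (σ * q 1 + H - σ * e 1)) := by
    refine (Reach.of_segment ?_).le ?_
    · intro z hz hzQ
      obtain ⟨t, ht0, ht1, hz⟩ := mem_segment_eq hz
      have := lt_of_mem_interior (a := 1) (b := c) (Or.inl one_ne_zero) (M := lin c e)
        (fun z hz => by simpa [lin] using he z hz) hzQ
      rw [hz 0, hz 1] at this
      unfold lin at this hBX
      have : t * (B 0 + c * B 1) = t * (e 0 + c * e 1) := by rw [hBX]
      linarith
    · refine (dist_le_abs_add_abs _ _).trans ?_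
      have h0 : B 0 - e 0 = c * (e 1 - B 1) := by unfold lin at hBX; linarith
      have h1 : |B 1 - e 1| = σ * q 1 + H - σ * e 1 := by
        have e1 : |B 1 - e 1| = |σ * (B 1 - e 1)| := by rw [abs_mul, hσa, one_mul]
        rw [e1, mul_sub, hB1, hσA, abs_of_nonneg (by linarith)]
      rw [h0, abs_mul, abs_of_nonneg hc, abs_sub_comm (e 1), h1]
      nlinarith
  exact (r1.trans r2).trans r3

/-- Walking around a hole: the cost is proportional to the progress in the direction `lin c`, up to
the vertical distance between extreme points for nearby directions. -/
theorem reach_hole_aux {Q : Set Plane} (hQ : Convex ℝ Q) (hcl : IsClosed Q) {c m δ : ℝ}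
    (hc : 0 ≤ c) (hc1 : c ≤ 1) (hm : 1 ≤ m) (hδ : m * δ = 1) {σ : ℝ} (hσ : σ = 1 ∨ σ = -1)
    {q e ep en a ap an : Plane} (hqQ : q ∈ Q) (heQ : e ∈ Q) (hepQ : ep ∈ Q) (henQ : en ∈ Q)
    (haQ : a ∈ Q) (hapQ : ap ∈ Q) (hanQ : an ∈ Q)
    (he : ∀ z ∈ Q, lin c z ≤ lin c e) (hep : ∀ z ∈ Q, lin (c + σ * δ) z ≤ lin (c + σ * δ) ep)
    (hen : ∀ z ∈ Q, lin (c - σ * δ) z ≤ lin (c - σ * δ) en)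
    (ha : ∀ z ∈ Q, lin c a ≤ lin c z) (hap : ∀ z ∈ Q, lin (c - σ * δ) ap ≤ lin (c - σ * δ) z)
    (han : ∀ z ∈ Q, lin (c + σ * δ) an ≤ lin (c + σ * δ) z)
    (hqe : lin c q < lin c e) {α β : ℝ} (hαβ : α ≠ 0 ∨ β ≠ 0) (hβ : 0 ≤ β)
    (hs : ∀ z ∈ Q, α * lin c z + β * (σ * z 1) ≤ α * lin c q + β * (σ * q 1)) :
    Reach (Q \ interior Q) q e (7 * m * (lin c e - lin c q) +
      6 * (σ * (ep 1 - en 1) + σ * (ap 1 - an 1))) := by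
  have hadd : ∀ z : Plane, m * lin (c + σ * δ) z = m * lin c z + σ * z 1 := fun z => by
    unfold lin; linear_combination σ * z 1 * hδ
  have hsub : ∀ z : Plane, m * lin (c - σ * δ) z = m * lin c z - σ * z 1 := fun z => by
    unfold lin; linear_combination -σ * z 1 * hδ
  have hm0 : 0 < m := by linarith
  have mm : ∀ {x y : ℝ}, x ≤ y → m * x ≤ m * y := fun h => mul_le_mul_of_nonneg_left h hm0.le
  have hep' : ∀ z ∈ Q, m * lin c z + σ * z 1 ≤ m * lin c ep + σ * ep 1 := fun z hz => by
    simpa only [hadd] using mm (hep z hz)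
  have hen' : ∀ z ∈ Q, m * lin c z - σ * z 1 ≤ m * lin c en - σ * en 1 := fun z hz => by
    simpa only [hsub] using mm (hen z hz)
  have hap' : ∀ z ∈ Q, m * lin c ap - σ * ap 1 ≤ m * lin c z - σ * z 1 := fun z hz => by
    simpa only [hsub] using mm (hap z hz)
  have han' : ∀ z ∈ Q, m * lin c an + σ * an 1 ≤ m * lin c z + σ * z 1 := fun z hz => by
    simpa only [hadd] using mm (han z hz)
  have e1 : σ * e 1 ≤ σ * ep 1 := by linarith [hep' e heQ, mm (he ep hepQ)]
  have e2 : σ * en 1 ≤ σ * e 1 := by linarith [hen' e heQ, mm (he en henQ)]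
  have a1 : σ * a 1 ≤ σ * ap 1 := by linarith [hap' a haQ, mm (ha ap hapQ)]
  have a2 : σ * an 1 ≤ σ * a 1 := by linarith [han' a haQ, mm (ha an hanQ)]
  set G := σ * (ep 1 - en 1) + σ * (ap 1 - an 1) with hG
  have hH0 : 0 ≤ G + m * (lin c e - lin c q) := by
    have := mul_nonneg hm0.le (sub_nonneg.2 hqe.le)
    linarith
  have hH : ∀ z ∈ Q, lin c q ≤ lin c z → σ * z 1 ≤ σ * q 1 + (G + m * (lin c e - lin c q)) := by
    intro z hz hqz
    have key : σ * z 1 ≤ σ * q 1 + G + m * (lin c z - lin c q) := by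
      rcases le_or_gt (-α) (β * m) with h | h
      · have hβ0 : 0 < β := by
          refine lt_of_le_of_ne hβ fun h0 => ?_
          subst h0
          have hα : 0 < α := lt_of_le_of_ne (by linarith) (Ne.symm (by simpa using hαβ))
          have := hs e heQ
          nlinarith
        have h1 := hs z hz
        have h2 : β * (σ * z 1 - σ * q 1) ≤ β * (m * (lin c z - lin c q)) := by
          nlinarith
        have := le_of_mul_le_mul_left h2 hβ0
        linarith
      · have hz1 := hap' z hz
        have hap1 := mm (ha ap hapQ)
        rcases hβ.eq_or_lt with h0 | hβ0
        · subst h0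
          have h1 := hs a haQ
          have h2 : lin c q ≤ lin c a := by nlinarith
          have h3 : lin c q = lin c a := le_antisymm h2 (ha q hqQ)
          have h4 := han' q hqQ
          have h5 := mm (ha an hanQ)
          rw [h3] at h4 ⊢
          linarith
        · have h1 := hs a haQ
          have h2 := ha q hqQ
          have h3 : β * (σ * a 1 - σ * q 1) ≤ β * (m * (lin c a - lin c q)) := by
            nlinarith
          have := le_of_mul_le_mul_left h3 hβ0
          linarith
    have := mm (he z hz)
    linarith
  refine (reach_box hQ hcl hc hc1 hσ hqQ heQ he hαβ hβ hs hH0 hH).le ?_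
  have h1 := hep' q hqQ
  have h2 := mm (he ep hepQ)
  have h3 : lin c e - lin c q ≤ m * (lin c e - lin c q) :=
    le_mul_of_one_le_left (sub_nonneg.2 hqe.le) hm
  linarith

theorem reach_hole {Q : Set Plane} (hQ : Convex ℝ Q) (hcl : IsClosed Q)
    (hne : (interior Q).Nonempty) {c m δ : ℝ}
    (hc : 0 ≤ c) (hc1 : c ≤ 1) (hm : 1 ≤ m) (hδ : m * δ = 1)
    {q e ep en a ap an : Plane} (hq : q ∈ Q \ interior Q) (heQ : e ∈ Q) (hepQ : ep ∈ Q)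
    (henQ : en ∈ Q) (haQ : a ∈ Q) (hapQ : ap ∈ Q) (hanQ : an ∈ Q)
    (he : ∀ z ∈ Q, lin c z ≤ lin c e) (hep : ∀ z ∈ Q, lin (c + δ) z ≤ lin (c + δ) ep)
    (hen : ∀ z ∈ Q, lin (c - δ) z ≤ lin (c - δ) en)
    (ha : ∀ z ∈ Q, lin c a ≤ lin c z) (hap : ∀ z ∈ Q, lin (c - δ) ap ≤ lin (c - δ) z)
    (han : ∀ z ∈ Q, lin (c + δ) an ≤ lin (c + δ) z) (hqe : lin c q < lin c e) :
    Reach (Q \ interior Q) q e (7 * m * (lin c e - lin c q) +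
      6 * ((ep 1 - en 1) + (ap 1 - an 1))) := by
  obtain ⟨α, β, hαβ, hs⟩ := exists_support hQ hne hq.2 c
  rcases le_total 0 β with hβ | hβ
  · simpa using reach_hole_aux (σ := 1) hQ hcl hc hc1 hm hδ (Or.inl rfl) hq.1 heQ hepQ henQ haQ
      hapQ hanQ he (by simpa using hep) (by simpa using hen) ha (by simpa using hap)
      (by simpa using han) hqe hαβ hβ (by simpa using hs)
  · refine (reach_hole_aux (σ := -1) hQ hcl hc hc1 hm hδ (Or.inr rfl) hq.1 heQ henQ hepQ haQ
      hanQ hapQ he (by simpa [← sub_eq_add_neg] using hen) (by simpa using hep) ha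
      (by simpa using han) (by simpa [← sub_eq_add_neg] using hap) hqe (α := α) (β := -β)
      (by simpa using hαβ) (by linarith) (by simpa using hs)).le ?_
    linarith

/-- Any two boundary points of the outer polygon, one of them extreme, are close along the
boundary. -/
theorem reach_outer_boundary {Q : Set Plane} (hQ : Convex ℝ Q) (hcp : IsCompact Q)
    (hne : (interior Q).Nonempty) {c D : ℝ} (hc : 0 ≤ c) (hc1 : c ≤ 1)
    (hD : ∀ r ∈ Q \ interior Q, ∀ r' ∈ Q \ interior Q, dist r r' ≤ D) {q e : Plane}
    (hq : q ∈ Q \ interior Q) (heQ : e ∈ Q \ interior Q) (he : ∀ z ∈ Q, lin c z ≤ lin c e) :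
    Reach (Q \ interior Q) q e (8 * D) := by
  have hH : ∀ σ : ℝ, σ = 1 ∨ σ = -1 → ∀ z ∈ Q, σ * z 1 ≤ σ * q 1 + D := by
    intro σ hσ z hz
    have hσa : |σ| = 1 := by rcases hσ with rfl | rfl <;> norm_num
    obtain ⟨w, hw, hmax⟩ := hcp.exists_isMaxOn ⟨q, hq.1⟩
      (f := fun z : Plane => σ * z 1) (by fun_prop)
    have hwi : w ∉ interior Q := fun hwi => by
      have := lt_of_mem_interior (a := 0) (b := σ) (M := σ * w 1)
        (Or.inr (by rintro rfl; simp at hσa)) (fun z hz => by simpa using hmax hz) hwi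
      simp at this
    have h1 := (abs_coord_sub_le_dist w q 1).trans (hD w ⟨hw, hwi⟩ q hq)
    have h2 : σ * (w 1 - q 1) ≤ |w 1 - q 1| := by
      refine (le_abs_self _).trans ?_
      rw [abs_mul, hσa, one_mul]
    have h3 : σ * z 1 ≤ σ * w 1 := hmax hz
    linarith
  have hd := hD e heQ q hq
  have hD0 : 0 ≤ D := dist_nonneg.trans hd
  have hX : lin c e - lin c q ≤ 2 * D := by
    have h0 := (le_abs_self _).trans ((abs_coord_sub_le_dist e q 0).trans hd)
    have h1 := (abs_coord_sub_le_dist e q 1).trans hd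
    have h2 := le_abs_self (e 1 - q 1)
    unfold lin
    nlinarith [abs_nonneg (e 1 - q 1)]
  have h1 := abs_le.1 ((abs_coord_sub_le_dist e q 1).trans hd)
  obtain ⟨α, β, hαβ, hs⟩ := exists_support hQ hne hq.2 c
  rcases le_total 0 β with hβ | hβ
  · refine (reach_box (σ := 1) hQ hcp.isClosed hc hc1 (Or.inl rfl) hq.1 heQ.1 he hαβ hβ
      (by simpa using hs) hD0 fun z hz _ => hH 1 (Or.inl rfl) z hz).le ?_
    linarith
  · refine (reach_box (σ := -1) hQ hcp.isClosed hc hc1 (Or.inr rfl) hq.1 heQ.1 he (a := α)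
      (b := -β) (by simpa using hαβ) (by linarith)
      (by simpa using hs) hD0 fun z hz _ => hH (-1) (Or.inr rfl) z hz).le ?_
    linarith

/-- Walk in a fixed direction, going around the holes on the way, until the outer boundary is
reached. -/
theorem reach_extreme {ι : Type*} [Fintype ι] {P₀ : Set Plane} {Q : ι → Set Plane}
    (hP₀ : Convex ℝ P₀) (hcp : IsCompact P₀) (hcl : ∀ i, IsClosed (Q i))
    (hdisj : Pairwise (Function.onFun Disjoint Q)) (hsub : ∀ i, Q i ⊆ interior P₀)
    {c b : ℝ} (hb : ∀ z ∈ P₀, lin c z ≤ b) {e₀ : Plane} {e : ι → Plane} (heQ : ∀ i, e i ∈ Q i)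
    (he : ∀ i, ∀ z ∈ Q i, lin c z ≤ lin c (e i)) {A K : ℝ} (hA : 1 ≤ A) {G : ι → ℝ}
    (hG : ∀ i, 0 ≤ G i)
    (hK : ∀ r ∈ P₀ \ interior P₀, Reach (P₀ \ interior P₀) r e₀ K)
    (hhole : ∀ i, (interior (Q i)).Nonempty → ∀ q ∈ Q i \ interior (Q i),
      lin c q < lin c (e i) →
        Reach (Q i \ interior (Q i)) q (e i) (A * (lin c (e i) - lin c q) + G i))
    {q : Plane} (hq : q ∈ P₀ \ ⋃ i, interior (Q i)) :
    Reach (P₀ \ ⋃ i, interior (Q i)) q e₀ (A * (b - lin c q) + ∑ i, G i + K) := by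
  classical
  have hout : P₀ \ interior P₀ ⊆ P₀ \ ⋃ i, interior (Q i) := fun z hz => ⟨hz.1, fun hm => by
    obtain ⟨i, hi⟩ := Set.mem_iUnion.1 hm
    exact hz.2 (hsub i (interior_subset hi))⟩
  have hin : ∀ i, Q i \ interior (Q i) ⊆ P₀ \ ⋃ j, interior (Q j) := fun i z hz =>
    ⟨interior_subset (hsub i hz.1), fun hm => by
      obtain ⟨j, hj⟩ := Set.mem_iUnion.1 hm
      rcases eq_or_ne i j with rfl | hij
      · exact hz.2 hj
      · exact Set.disjoint_left.1 (hdisj hij) hz.1 (interior_subset hj)⟩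
  have hei : ∀ i, e i ∉ interior (Q i) := fun i hi => by
    have := lt_of_mem_interior (a := 1) (b := c) (Or.inl one_ne_zero) (M := lin c (e i))
      (fun z hz => by simpa [lin] using he i z hz) hi
    simp [lin] at this
  suffices H : ∀ (n : ℕ) (q : Plane), q ∈ P₀ \ ⋃ i, interior (Q i) →
      (Finset.univ.filter fun i => lin c q < lin c (e i)).card = n →
      Reach (P₀ \ ⋃ i, interior (Q i)) q e₀
        (A * (b - lin c q) + ∑ i with lin c q < lin c (e i), G i + K) by
    refine (H _ q hq rfl).le ?_
    have : ∑ i with lin c q < lin c (e i), G i ≤ ∑ i, G i :=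
      Finset.sum_le_sum_of_subset_of_nonneg (Finset.filter_subset _ _) fun i _ _ => hG i
    linarith
  intro n
  induction n using Nat.strong_induction_on with | _ n ih
  intro q hq hcard
  set U : Set Plane := ⋃ i, interior (Q i) with hU
  have hUo : IsOpen U := isOpen_iUnion fun i => isOpen_interior
  set p : ℝ → Plane := fun t => q + t • !₂[1, 0] with hp
  have hpc : Continuous p := by fun_prop
  have hpX : ∀ t, lin c (p t) = lin c q + t := fun t => by simp [hp, lin]; ring
  have hp0 : p 0 = q := by simp [hp]
  have hpseg : ∀ t, 0 ≤ t → ∀ V : Set Plane, (∀ u, 0 ≤ u → u ≤ t → p u ∈ V) →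
      Reach V q (p t) t := by
    intro t ht V hV
    refine (Reach.of_segment ?_).le ?_
    · intro z hz
      rw [segment_eq_image'] at hz
      obtain ⟨u, hu, rfl⟩ := hz
      have := hV (u * t) (mul_nonneg hu.1 ht) (mul_le_of_le_one_left ht hu.2)
      simpa [hp, smul_smul] using this
    · simp [hp, norm_smul, EuclideanSpace.norm_eq, abs_of_nonneg ht]
  set E : Set ℝ := {t | 0 ≤ t ∧ p t ∈ P₀} with hE
  have hEcl : IsClosed E := isClosed_Ici.inter (hcp.isClosed.preimage hpc)
  have hEbd : BddAbove E := ⟨b - lin c q, fun t ht => by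
    have := hb _ ht.2
    rw [hpX] at this
    linarith⟩
  have hE0 : (0 : ℝ) ∈ E := ⟨le_rfl, by rw [hp0]; exact hq.1⟩
  have hT := hEcl.csSup_mem ⟨0, hE0⟩ hEbd
  set T := sSup E with hTdef
  have hpP₀ : ∀ u, 0 ≤ u → u ≤ T → p u ∈ P₀ := by
    intro u hu0 huT
    rcases hu0.eq_or_lt with rfl | hu0
    · exact hE0.2
    have hT0 : 0 < T := hu0.trans_le huT
    have hcomb := hP₀ hq.1 hT.2 (a := 1 - u / T) (b := u / T)
      (sub_nonneg.2 (div_le_one_of_le₀ huT hT0.le)) (by positivity) (by ring)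
    have e1 : (1 - u / T) • q + (u / T) • p T = p u := by
      simp only [hp, smul_add, smul_smul, div_mul_cancel₀ _ hT0.ne']
      module
    rwa [e1] at hcomb
  have hTi : p T ∉ interior P₀ := fun hi => by
    obtain ⟨t, ht, hm⟩ := exists_pos_add_smul_mem hi !₂[1, 0]
    have : T + t ∈ E := ⟨by linarith [hT.1], by
      convert hm using 1
      simp only [hp]
      module⟩
    linarith [le_csSup hEbd this]
  by_cases hhit : ∃ t, 0 ≤ t ∧ p t ∈ U
  · set B : Set ℝ := {t | 0 ≤ t ∧ p t ∈ U} with hB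
    have hBbd : BddBelow B := ⟨0, fun t ht => ht.1⟩
    have hτ : sInf B ∈ closure B := csInf_mem_closure hhit hBbd
    set τ := sInf B with hτdef
    have hτ0 : 0 ≤ τ := le_csInf hhit fun t ht => ht.1
    have hUP : U ⊆ P₀ := Set.iUnion_subset fun i =>
      interior_subset.trans ((hsub i).trans interior_subset)
    have hτT : τ ≤ T := by
      obtain ⟨t, ht⟩ := hhit
      exact (csInf_le hBbd ht).trans (le_csSup hEbd ⟨ht.1, hUP ht.2⟩)
    have hτU : p τ ∉ U := fun hm => by
      rcases hτ0.eq_or_lt with h0 | h0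
      · rw [← h0, hp0] at hm
        exact hq.2 hm
      · have hev : ∀ᶠ t in nhdsWithin τ (Set.Iio τ), p t ∈ U ∧ 0 < t :=
          (((hUo.preimage hpc).inter isOpen_Ioi).mem_nhds ⟨hm, h0⟩ : _ ∈ nhds τ)
            |> mem_nhdsWithin_of_mem_nhds
        obtain ⟨t, ht, htτ⟩ := (hev.and self_mem_nhdsWithin).exists
        exact absurd (csInf_le hBbd ⟨ht.2.le, ht.1⟩) (not_le.2 htτ)
    have hfree : ∀ u, 0 ≤ u → u ≤ τ → p u ∈ P₀ \ U := fun u hu0 huτ =>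
      ⟨hpP₀ u hu0 (huτ.trans hτT), fun hm => by
        rcases huτ.eq_or_lt with rfl | hlt
        · exact hτU hm
        · exact absurd (csInf_le hBbd ⟨hu0, hm⟩) (not_le.2 hlt)⟩
    have hBU : B = ⋃ i, {t | 0 ≤ t ∧ p t ∈ interior (Q i)} := by
      ext t
      simp [hB, hU]
    rw [hBU, closure_iUnion_of_finite] at hτ
    obtain ⟨i, hi⟩ := Set.mem_iUnion.1 hτ
    have hQi : p τ ∈ Q i := closure_minimal
      (fun t ht => interior_subset (s := Q i) ht.2 : _ ⊆ p ⁻¹' Q i) ((hcl i).preimage hpc) hi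
    obtain ⟨t, ht⟩ := closure_nonempty_iff.1 ⟨_, hi⟩
    have htτ : τ ≤ t := csInf_le hBbd (by rw [hBU]; exact Set.mem_iUnion.2 ⟨i, ht⟩)
    have hlt : lin c (p τ) < lin c (e i) := by
      have := lt_of_mem_interior (a := 1) (b := c) (Or.inl one_ne_zero) (M := lin c (e i))
        (fun z hz => by simpa [lin] using he i z hz) ht.2
      have e1 := hpX t
      have e2 := hpX τ
      unfold lin at *
      linarith
    have hqi : lin c q < lin c (e i) := by rw [hpX] at hlt; linarith
    have hsubset : (Finset.univ.filter fun j => lin c (e i) < lin c (e j)) ⊆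
        (Finset.univ.filter fun j => lin c q < lin c (e j)).erase i := by
      intro j hj
      simp only [Finset.mem_filter, Finset.mem_univ, true_and, Finset.mem_erase] at hj ⊢
      exact ⟨by rintro rfl; exact lt_irrefl _ hj, hqi.trans hj⟩
    have himem : i ∈ Finset.univ.filter fun j => lin c q < lin c (e j) := by simpa using hqi
    have hsum := Finset.sum_le_sum_of_subset_of_nonneg hsubset (f := G) fun j _ _ => hG j
    have hsum' := Finset.sum_erase_add _ G himem
    have r1 := hpseg τ hτ0 _ hfree
    have r2 := (hhole i ⟨_, ht.2⟩ (p τ)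
      ⟨hQi, fun hm => hτU (Set.mem_iUnion.2 ⟨i, hm⟩)⟩ hlt).mono (hin i)
    have hcard' := (Finset.card_le_card hsubset).trans_lt
      (Finset.card_lt_card (Finset.erase_ssubset himem))
    have r3 := ih _ (hcard ▸ hcard') (e i) (hin i ⟨heQ i, hei i⟩) rfl
    refine ((r1.trans r2).trans r3).le ?_
    rw [hpX]
    nlinarith
  · push Not at hhit
    have r1 := hpseg T hT.1 (P₀ \ U) fun u hu0 huT => ⟨hpP₀ u hu0 huT, hhit u hu0⟩
    refine (r1.trans ((hK (p T) ⟨hT.2, hTi⟩).mono hout)).le ?_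
    have h1 := hb _ hT.2
    rw [hpX] at h1
    have h2 : 0 ≤ ∑ i with lin c q < lin c (e i), G i := Finset.sum_nonneg fun i _ => hG i
    nlinarith [hT.1]

theorem sum_range_sub_two_le (f : ℕ → ℝ) {d : ℝ} (hd : ∀ i j, f i - f j ≤ d) (N : ℕ) :
    ∑ k ∈ Finset.range N, (f (k + 2) - f k) ≤ 2 * d := by
  have h : ∑ k ∈ Finset.range N, (f (k + 2) - f k) = f (N + 1) + f N - f 1 - f 0 := by
    induction N with
    | zero => simp
    | succ n ih => rw [Finset.sum_range_succ, ih]; ring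
  rw [h]
  linarith [hd (N + 1) 1, hd N 0]

/-- Maximizers of `lin c` have `z₁`-coordinates monotone in `c`. -/
theorem coord_le_of_isMax {c c' : ℝ} (hcc : c < c') {x y : Plane} (hx : lin c y ≤ lin c x)
    (hy : lin c' x ≤ lin c' y) : x 1 ≤ y 1 := by
  unfold lin at hx hy
  by_contra! hlt
  nlinarith [mul_pos (sub_pos.2 hcc) (sub_pos.2 hlt)]

/-- Minimizers of `lin c` have `z₁`-coordinates antitone in `c`. -/
theorem coord_le_of_isMin {c c' : ℝ} (hcc : c < c') {x y : Plane} (hx : lin c x ≤ lin c y)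
    (hy : lin c' y ≤ lin c' x) : y 1 ≤ x 1 := by
  unfold lin at hx hy
  by_contra! hlt
  nlinarith [mul_pos (sub_pos.2 hcc) (sub_pos.2 hlt)]

theorem IsConvexPolygon.convex {Q : Set Plane} (h : IsConvexPolygon Q) : Convex ℝ Q := by
  obtain ⟨S, -, rfl⟩ := h
  exact convex_convexHull ℝ _

theorem IsConvexPolygon.isCompact {Q : Set Plane} (h : IsConvexPolygon Q) : IsCompact Q := by
  obtain ⟨S, -, rfl⟩ := h
  exact S.finite_toSet.isCompact_convexHull ℝ

theorem IsConvexPolygon.nonempty {Q : Set Plane} (h : IsConvexPolygon Q) : Q.Nonempty := by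
  obtain ⟨S, hS, rfl⟩ := h
  exact (Finset.coe_nonempty.2 hS).convexHull

/-- The bound for holes of diameter at most `d`, for a direction chosen among `lin (k / N)`,
`1 ≤ k ≤ N`, by averaging. -/
theorem geodDiam_le {ι : Type*} [Fintype ι] [Nonempty ι] {P₀ : Set Plane} {Q : ι → Set Plane}
    (hP₀ : IsConvexPolygon P₀) (hQ : ∀ i, IsConvexPolygon (Q i))
    (hdisj : Pairwise (Function.onFun Disjoint Q)) (hsub : ∀ i, Q i ⊆ interior P₀)
    {d D : ℝ} (hd : ∀ i, Metric.diam (Q i) ≤ d)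
    (hD : ∀ s ∈ P₀ \ ⋃ i, interior (Q i), ∀ t ∈ P₀ \ ⋃ i, interior (Q i), dist s t ≤ D)
    {N : ℕ} (hN : 1 ≤ N) :
    geodDiam (P₀ \ ⋃ i, interior (Q i)) ≤
      ENNReal.ofReal (2 * (7 * N * (2 * D) + 24 * (Fintype.card ι * d) / N + 8 * D)) := by
  have hout : P₀ \ interior P₀ ⊆ P₀ \ ⋃ i, interior (Q i) := fun z hz => ⟨hz.1, fun hm => by
    obtain ⟨i, hi⟩ := Set.mem_iUnion.1 hm
    exact hz.2 (hsub i (interior_subset hi))⟩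
  have hN0 : (0 : ℝ) < N := by exact_mod_cast hN
  have hN1 : (1 : ℝ) ≤ N := by exact_mod_cast hN
  have hmax : ∀ i (k : ℕ), ∃ e ∈ Q i, ∀ z ∈ Q i, lin (k / N) z ≤ lin (k / N) e := fun i k =>
    (hQ i).isCompact.exists_isMaxOn (hQ i).nonempty (continuous_lin _).continuousOn
  have hmin : ∀ i (k : ℕ), ∃ a ∈ Q i, ∀ z ∈ Q i, lin (k / N) a ≤ lin (k / N) z := fun i k =>
    (hQ i).isCompact.exists_isMinOn (hQ i).nonempty (continuous_lin _).continuousOn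
  choose e heQ he using hmax
  choose a haQ ha using hmin
  have hlt : ∀ k : ℕ, (k : ℝ) / N < ((k + 2 : ℕ) : ℝ) / N := fun k =>
    div_lt_div_of_pos_right (by push_cast; linarith) hN0
  have hG0 : ∀ i k, 0 ≤ (e i (k + 2) 1 - e i k 1) + (a i k 1 - a i (k + 2) 1) := by
    intro i k
    have h1 := coord_le_of_isMax (hlt k) (he i k _ (heQ i (k + 2))) (he i (k + 2) _ (heQ i k))
    have h2 := coord_le_of_isMin (hlt k) (ha i k _ (haQ i (k + 2))) (ha i (k + 2) _ (haQ i k))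
    linarith
  have hdiam : ∀ i, ∀ x ∈ Q i, ∀ y ∈ Q i, x 1 - y 1 ≤ d := fun i x hx y hy =>
    (le_abs_self _).trans ((abs_coord_sub_le_dist x y 1).trans
      ((Metric.dist_le_diam_of_mem (hQ i).isCompact.isBounded hx hy).trans (hd i)))
  have hGsum : ∀ i, ∑ k ∈ Finset.range N,
      ((e i (k + 2) 1 - e i k 1) + (a i k 1 - a i (k + 2) 1)) ≤ 4 * d := by
    intro i
    have h1 := sum_range_sub_two_le (fun k => e i k 1)
      (fun j k => hdiam i _ (heQ i j) _ (heQ i k)) N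
    have h2 := sum_range_sub_two_le (fun k => -a i k 1) (d := d)
      (fun j k => by have := hdiam i _ (haQ i k) _ (haQ i j); linarith) N
    simp only [sub_neg_eq_add, neg_add_eq_sub] at h2
    rw [Finset.sum_add_distrib]
    linarith
  obtain ⟨k, hk, hkG⟩ : ∃ k ∈ Finset.range N,
      ∑ i, ((e i (k + 2) 1 - e i k 1) + (a i k 1 - a i (k + 2) 1)) ≤
        4 * (Fintype.card ι * d) / N := by
    refine Finset.exists_le_of_sum_le ⟨0, Finset.mem_range.2 hN⟩ ?_
    rw [Finset.sum_comm, Finset.sum_const, Finset.card_range, nsmul_eq_mul,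
      mul_div_cancel₀ _ hN0.ne']
    refine (Finset.sum_le_sum fun i _ => hGsum i).trans ?_
    rw [Finset.sum_const, Finset.card_univ, nsmul_eq_mul]
    linarith
  set c : ℝ := ((k + 1 : ℕ) : ℝ) / N with hc
  have hc0 : 0 ≤ c := by positivity
  have hc1 : c ≤ 1 := div_le_one_of_le₀
    (by exact_mod_cast Nat.succ_le_of_lt (Finset.mem_range.1 hk)) hN0.le
  have hcp : c + 1 / N = ((k + 2 : ℕ) : ℝ) / N := by rw [hc]; push_cast; ring
  have hcm : c - 1 / N = (k : ℝ) / N := by rw [hc]; push_cast; ring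
  have hne : (interior P₀).Nonempty := by
    obtain ⟨i⟩ := ‹Nonempty ι›
    exact (hQ i).nonempty.mono (hsub i)
  obtain ⟨e₀, he₀, hmax₀⟩ := hP₀.isCompact.exists_isMaxOn hP₀.nonempty
    (continuous_lin c).continuousOn
  have he₀i : e₀ ∉ interior P₀ := fun hi => by
    have := lt_of_mem_interior (a := 1) (b := c) (Or.inl one_ne_zero) (M := lin c e₀)
      (fun z hz => by simpa [lin] using hmax₀ hz) hi
    simp [lin] at this
  have main : ∀ q ∈ P₀ \ ⋃ i, interior (Q i), Reach (P₀ \ ⋃ i, interior (Q i)) q e₀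
      (7 * N * (2 * D) + 24 * (Fintype.card ι * d) / N + 8 * D) := by
    intro q hq
    have hA : (1 : ℝ) ≤ 7 * N := by linarith
    refine (reach_extreme hP₀.convex hP₀.isCompact (fun i => (hQ i).isCompact.isClosed) hdisj hsub
      (b := lin c e₀) (fun z hz => hmax₀ hz) (fun i => heQ i (k + 1)) (fun i => he i (k + 1)) hA
      (G := fun i => 6 * ((e i (k + 2) 1 - e i k 1) + (a i k 1 - a i (k + 2) 1)))
      (fun i => mul_nonneg (by norm_num) (hG0 i k)) (K := 8 * D)
      (fun r hr => reach_outer_boundary hP₀.convex hP₀.isCompact hne hc0 hc1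
        (fun x hx y hy => hD x (hout hx) y (hout hy)) hr ⟨he₀, he₀i⟩ fun z hz => hmax₀ hz)
      (fun i hi x hx hlt => reach_hole (hQ i).convex (hQ i).isCompact.isClosed hi hc0 hc1 hN1
        (δ := 1 / N) (by field_simp) hx (heQ i (k + 1)) (heQ i (k + 2)) (heQ i k)
        (haQ i (k + 1)) (haQ i k) (haQ i (k + 2)) (he i (k + 1))
        (by rw [hcp]; exact he i (k + 2)) (by rw [hcm]; exact he i k) (ha i (k + 1))
        (by rw [hcm]; exact ha i k) (by rw [hcp]; exact ha i (k + 2)) hlt) hq).le ?_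
    have hdist := hD e₀ (hout ⟨he₀, he₀i⟩) q hq
    have hX : lin c e₀ - lin c q ≤ 2 * D := by
      have h0 := (le_abs_self _).trans ((abs_coord_sub_le_dist e₀ q 0).trans hdist)
      have h1 := (abs_coord_sub_le_dist e₀ q 1).trans hdist
      have h2 := le_abs_self (e₀ 1 - q 1)
      unfold lin
      nlinarith [abs_nonneg (e₀ 1 - q 1)]
    rw [← Finset.mul_sum]
    have h1 : 7 * N * (lin c e₀ - lin c q) ≤ 7 * N * (2 * D) :=
      mul_le_mul_of_nonneg_left hX (by positivity)
    have h2 : 24 * (Fintype.card ι * d) / N = 6 * (4 * (Fintype.card ι * d) / N) := by ring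
    rw [h2]
    linarith
  refine iSup₂_le fun s hs => iSup₂_le fun t ht => ?_
  rw [two_mul]
  exact ((main s hs).trans (main t ht).symm).geod_le

/-- There is an absolute constant `C > 0` such that for every `h ≥ 1` and every
polygonal domain `P ∈ 𝒞(h)` whose holes satisfy `diam₂(Pᵢ) ≤ h^{-1/3}·diam₂(P)`,
we have `diam_g(P) ≤ C·h^{1/3}·diam₂(P)`. -/
theorem geodesic_diameter_small_holes :
    ∃ C : ℝ, 0 < C ∧
      ∀ (h : ℕ), 1 ≤ h →
        ∀ (P₀ : Set Plane) (Q : Fin h → Set Plane),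
          IsConvexPolygon P₀ →
          (∀ i, IsConvexPolygon (Q i)) →
          Pairwise (Function.onFun Disjoint Q) →
          (∀ i, Q i ⊆ interior P₀) →
          (∀ i, Metric.diam (Q i) ≤
              (h : ℝ) ^ (-(1 : ℝ) / 3) * Metric.diam (P₀ \ ⋃ j, interior (Q j))) →
          geodDiam (P₀ \ ⋃ i, interior (Q i)) ≤
            ENNReal.ofReal
              (C * (h : ℝ) ^ ((1 : ℝ) / 3) *
                Metric.diam (P₀ \ ⋃ i, interior (Q i))) := by
  refine ⟨120, by norm_num, fun h hh P₀ Q hP₀ hQ hdisj hsub hdiam => ?_⟩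
  have : Nonempty (Fin h) := ⟨⟨0, hh⟩⟩
  set D := Metric.diam (P₀ \ ⋃ i, interior (Q i)) with hD
  have hD0 : 0 ≤ D := Metric.diam_nonneg
  have hh1 : (1 : ℝ) ≤ h := by exact_mod_cast hh
  have hh0 : (0 : ℝ) < h := by linarith
  set x : ℝ := (h : ℝ) ^ ((1 : ℝ) / 3) with hx
  have hx1 : 1 ≤ x := Real.one_le_rpow hh1 (by norm_num)
  have hx0 : 0 < x := by linarith
  have hhx : (h : ℝ) * (h : ℝ) ^ (-(1 : ℝ) / 3) = x * x := by
    rw [hx, ← Real.rpow_add hh0]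
    nth_rewrite 1 [← Real.rpow_one (h : ℝ)]
    rw [← Real.rpow_add hh0]
    norm_num
  have hN : 1 ≤ ⌈x⌉₊ := Nat.one_le_iff_ne_zero.2 (Nat.ceil_pos.2 hx0).ne'
  refine (geodDiam_le hP₀ hQ hdisj hsub hdiam (D := D) (fun s hs t ht =>
    Metric.dist_le_diam_of_mem (hP₀.isCompact.isBounded.subset Set.sdiff_subset) hs ht) hN).trans
    (ENNReal.ofReal_le_ofReal ?_)
  have h1 : x ≤ ⌈x⌉₊ := Nat.le_ceil x
  have h2 : (⌈x⌉₊ : ℝ) ≤ 2 * x := by linarith [Nat.ceil_lt_add_one hx0.le]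
  have h3 : 24 * ((Fintype.card (Fin h) : ℝ) * ((h : ℝ) ^ (-(1 : ℝ) / 3) * D)) / ⌈x⌉₊ ≤
      24 * (x * D) := by
    rw [Fintype.card_fin, ← mul_assoc (h : ℝ), hhx, div_le_iff₀ (hx0.trans_le h1)]
    have : 0 ≤ x * D := mul_nonneg hx0.le hD0
    nlinarith
  have h4 : 7 * (⌈x⌉₊ : ℝ) * (2 * D) ≤ 7 * (2 * x) * (2 * D) := by gcongr
  have h5 : D ≤ x * D := le_mul_of_one_le_left hD0 hx1
  linarith
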